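/- Let w ∈ W^{P_k} be odd-symplectic with w(1) = 1, corresponding to λ ∈ Λ with λ_1 = 2n+1-k. Let O_2 = (1 < 3 < 4 < ⋯ < k < \overline{2}). Then λ** exists (i.e., λ_2 = 2n-k) if and only if wO_2 is a minimal length representative in W^{odd} with ℓ(wO_2) = ℓ(w) + ℓ(O_2); and in that case wO_2 corresponds to λ**. -/

import Mathlib

def bar (n : ℕ) (i : Fin (2*n+2)) : Fin (2*n+2) := ⟨2*n+1 - i, by have := i.isLt; omega⟩

def IsSigned (n : ℕ) (w : Equiv.Perm (Fin (2*n+2))) : Prop :=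
  ∀ i, w (bar n i) = bar n (w i)

def IsOddSymp (n : ℕ) (w : Equiv.Perm (Fin (2*n+2))) : Prop :=
  ∀ j : Fin (2*n+2), (j : ℕ) < n+1 → (w j : ℕ) ≠ 2*n+1

def sgen (n : ℕ) (i : Fin (n+1)) : Equiv.Perm (Fin (2*n+2)) :=
  if h : (i : ℕ) < n then
    (Equiv.swap ⟨i, by omega⟩ ⟨(i : ℕ)+1, by omega⟩) *
      (Equiv.swap ⟨2*n - i, by omega⟩ ⟨2*n+1 - i, by omega⟩)
  else Equiv.swap ⟨n, by omega⟩ ⟨n+1, by omega⟩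

noncomputable def len (n : ℕ) (w : Equiv.Perm (Fin (2*n+2))) : ℕ :=
  sInf {m | ∃ l : List (Fin (n+1)), l.length = m ∧ (l.map (sgen n)).prod = w}

def WP (n k : ℕ) : Subgroup (Equiv.Perm (Fin (2*n+2))) :=
  Subgroup.closure {x | ∃ i : Fin (n+1), (i : ℕ) ≠ k - 1 ∧ x = sgen n i}

noncomputable def IsMinRep (n k : ℕ) (w : Equiv.Perm (Fin (2*n+2))) : Prop :=
  ∀ p ∈ WP n k, len n w ≤ len n (w * p)

noncomputable def cosetLen (n k : ℕ) (w : Equiv.Perm (Fin (2*n+2))) : ℕ :=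
  sInf {m | ∃ p ∈ WP n k, len n (w * p) = m}

def s2t1 (n : ℕ) : Equiv.Perm (Fin (2*n+2)) := Equiv.swap ⟨0, by omega⟩ ⟨2*n+1, by omega⟩

def st1t2 (n : ℕ) : Equiv.Perm (Fin (2*n+2)) :=
  Equiv.swap ⟨0, by omega⟩ ⟨2*n, by omega⟩ * Equiv.swap ⟨1, by omega⟩ ⟨2*n+1, by omega⟩

/-- The `(n-k)`-strict partition associated to a minimal length representative in
`W^{P_k} ∩ W^{odd}`: `λ_j = 2n+2-k-w(j) + #{i<j : w(i)+w(j) > 2n+3}` (values 1-based). -/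
def partOf (n k : ℕ) (hk : k ≤ 2*n+2) (σ : Equiv.Perm (Fin (2*n+2))) (j : Fin k) : ℤ :=
  ((2*n+2 : ℤ) - k) - (((σ (Fin.castLE hk j) : ℕ) : ℤ) + 1) +
    (Finset.univ.filter (fun i : Fin k => i < j ∧
      ((σ (Fin.castLE hk i) : ℕ) + 1) + ((σ (Fin.castLE hk j) : ℕ) + 1) > 2*n+3)).card

/-- `λ* = (λ_2, λ_3, ..., λ_k, 0)`. -/
def starP (k : ℕ) (lam : Fin k → ℤ) (j : Fin k) : ℤ :=
  if h : (j : ℕ) + 1 < k then lam ⟨(j : ℕ)+1, h⟩ else 0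

/-- `λ** = (λ_1, λ_3, ..., λ_k, -1)`. -/
def dstarP (k : ℕ) (hk : 0 < k) (lam : Fin k → ℤ) (j : Fin k) : ℤ :=
  if (j : ℕ) = 0 then lam ⟨0, hk⟩
  else if h : (j : ℕ) + 1 < k then lam ⟨(j : ℕ)+1, h⟩ else -1

theorem card_xor_aux {α : Type*} [Fintype α] (P Q R : α → Prop) [DecidablePred P]
    [DecidablePred Q] [DecidablePred R] :
    (Finset.univ.filter (fun a => ¬(P a ↔ Q a))).card
      + (Finset.univ.filter (fun a => ¬(Q a ↔ R a))).card
    = (Finset.univ.filter (fun a => ¬(P a ↔ R a))).card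
      + 2 * (Finset.univ.filter (fun a => ¬(P a ↔ Q a) ∧ ¬(Q a ↔ R a))).card := by
  simp only [Finset.card_filter]
  rw [Finset.mul_sum, ← Finset.sum_add_distrib, ← Finset.sum_add_distrib]
  apply Finset.sum_congr rfl
  intro a _
  by_cases h1 : P a <;> by_cases h2 : Q a <;> by_cases h3 : R a <;> simp [h1, h2, h3]

/-- number of ordered pairs whose relative order is changed -/
def dA (n : ℕ) (w : Equiv.Perm (Fin (2*n+2))) : ℕ :=
  (Finset.univ.filter (fun p : Fin (2*n+2) × Fin (2*n+2) =>
    ¬(p.1 < p.2 ↔ w p.1 < w p.2))).card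

/-- number of indices whose sign is changed -/
def dB (n : ℕ) (w : Equiv.Perm (Fin (2*n+2))) : ℕ :=
  (Finset.univ.filter (fun x : Fin (2*n+2) => ¬((x : ℕ) ≤ n ↔ (w x : ℕ) ≤ n))).card

def bA (n : ℕ) (u v : Equiv.Perm (Fin (2*n+2))) : ℕ :=
  (Finset.univ.filter (fun p : Fin (2*n+2) × Fin (2*n+2) =>
    ¬(p.1 < p.2 ↔ v p.1 < v p.2) ∧ ¬(v p.1 < v p.2 ↔ u (v p.1) < u (v p.2)))).card

def bB (n : ℕ) (u v : Equiv.Perm (Fin (2*n+2))) : ℕ :=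
  (Finset.univ.filter (fun x : Fin (2*n+2) => ¬((x : ℕ) ≤ n ↔ (v x : ℕ) ≤ n) ∧
    ¬((v x : ℕ) ≤ n ↔ (u (v x) : ℕ) ≤ n))).card

theorem dA_mul (n : ℕ) (u v : Equiv.Perm (Fin (2*n+2))) :
    dA n v + dA n u = dA n (u * v) + 2 * bA n u v := by
  have h := card_xor_aux (α := Fin (2*n+2) × Fin (2*n+2)) (fun p => p.1 < p.2)
    (fun p => v p.1 < v p.2) (fun p => u (v p.1) < u (v p.2))
  have h2 : dA n u = (Finset.univ.filter (fun p : Fin (2*n+2) × Fin (2*n+2) =>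
      ¬(v p.1 < v p.2 ↔ u (v p.1) < u (v p.2)))).card := by
    unfold dA
    symm
    apply Finset.card_equiv (Equiv.prodCongr v v)
    intro p
    simp
  rw [h2]
  exact h

theorem dB_mul (n : ℕ) (u v : Equiv.Perm (Fin (2*n+2))) :
    dB n v + dB n u = dB n (u * v) + 2 * bB n u v := by
  have h := card_xor_aux (α := Fin (2*n+2)) (fun p => (p : ℕ) ≤ n)
    (fun p => (v p : ℕ) ≤ n) (fun p => (u (v p) : ℕ) ≤ n)
  have h2 : dB n u = (Finset.univ.filter (fun p : Fin (2*n+2) =>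
      ¬((v p : ℕ) ≤ n ↔ (u (v p) : ℕ) ≤ n))).card := by
    unfold dB
    symm
    apply Finset.card_equiv v
    intro p
    simp
  rw [h2]
  exact h

def dD (n : ℕ) (w : Equiv.Perm (Fin (2*n+2))) : ℕ := dA n w + dB n w

theorem bar_val (n : ℕ) (i : Fin (2*n+2)) : (bar n i : ℕ) = 2*n+1 - i := rfl

theorem bar_bar (n : ℕ) (i : Fin (2*n+2)) : bar n (bar n i) = i := by
  apply Fin.ext; simp only [bar_val]; have := i.isLt; omega

theorem signed_val {n : ℕ} {w : Equiv.Perm (Fin (2*n+2))} (hw : IsSigned n w)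
    (x y : Fin (2*n+2)) (h : (x : ℕ) + y = 2*n+1) : (w x : ℕ) + w y = 2*n+1 := by
  have : y = bar n x := by apply Fin.ext; simp only [bar_val]; omega
  rw [this, hw x, bar_val]; have := (w x).isLt; omega

theorem signed_mul {n : ℕ} {u v : Equiv.Perm (Fin (2*n+2))} (hu : IsSigned n u)
    (hv : IsSigned n v) : IsSigned n (u * v) := by
  intro i; simp only [Equiv.Perm.mul_apply]; rw [hv, hu]

theorem signed_inv {n : ℕ} {u : Equiv.Perm (Fin (2*n+2))} (hu : IsSigned n u) :
    IsSigned n u⁻¹ := by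
  intro i
  rw [Equiv.Perm.inv_eq_iff_eq, hu]; simp

/-- `u` and `v` compose without cancellation -/
def Reduced (n : ℕ) (u v : Equiv.Perm (Fin (2*n+2))) : Prop :=
  ∀ i j, i < j → v j < v i → u (v j) < u (v i)

theorem dD_add_iff {n : ℕ} {u v : Equiv.Perm (Fin (2*n+2))} (hu : IsSigned n u)
    (hv : IsSigned n v) : dD n (u * v) = dD n u + dD n v ↔ Reduced n u v := by
  have h1 := dA_mul n u v
  have h2 := dB_mul n u v
  have key : (bA n u v = 0 ∧ bB n u v = 0) ↔ Reduced n u v := by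
    unfold bA bB Reduced
    simp only [Finset.card_eq_zero, Finset.filter_eq_empty_iff, Finset.mem_univ, true_implies,
      Prod.forall]
    constructor
    · rintro ⟨h, -⟩ i j hij hvij
      have := h i j
      have := u.injective.ne hvij.ne
      omega
    · intro h
      have hh : ∀ i j : Fin (2*n+2), ¬(¬(i < j ↔ v i < v j) ∧
          ¬(v i < v j ↔ u (v i) < u (v j))) := by
        intro i j
        have a := h i j
        have b := h j i
        by_cases hij : i = j
        · subst hij; simp
        have := v.injective.ne hij
        have := u.injective.ne this
        omega
      refine ⟨hh, ?_⟩
      intro x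
      have := hh x (bar n x)
      have e1 : (v (bar n x) : ℕ) = 2*n+1 - v x := by rw [hv, bar_val]
      have e2 : (u (v (bar n x)) : ℕ) = 2*n+1 - u (v x) := by rw [hv, hu, bar_val]
      have e3 := bar_val n x
      simp only [Fin.lt_def] at this
      omega
  rw [← key]
  unfold dD
  omega

theorem sgen_val (n : ℕ) (i : Fin (n+1)) (x : Fin (2*n+2)) :
    (sgen n i x : ℕ) = if (i : ℕ) < n then
      (if (x : ℕ) = i then (i : ℕ)+1 else if (x : ℕ) = i+1 then (i : ℕ) else
        if (x : ℕ) = 2*n-i then 2*n+1-i else if (x : ℕ) = 2*n+1-i then 2*n-i else x)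
      else (if (x : ℕ) = n then n+1 else if (x : ℕ) = n+1 then n else x) := by
  unfold sgen
  have := i.isLt
  have := x.isLt
  split
  · simp only [Equiv.Perm.mul_apply, Equiv.swap_apply_def, Fin.ext_iff, apply_ite Fin.val]
    split_ifs <;> omega
  · simp only [Equiv.swap_apply_def, Fin.ext_iff, apply_ite Fin.val]

theorem sgen_signed (n : ℕ) (i : Fin (n+1)) : IsSigned n (sgen n i) := by
  intro x
  apply Fin.ext
  have := i.isLt
  have := x.isLt
  rw [bar_val, sgen_val, sgen_val, bar_val]
  split_ifs <;> omega

theorem sgen_sq (n : ℕ) (i : Fin (n+1)) : sgen n i * sgen n i = 1 := by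
  apply Equiv.ext
  intro x
  apply Fin.ext
  have := i.isLt
  have := x.isLt
  simp only [Equiv.Perm.mul_apply, Equiv.Perm.one_apply]
  rw [sgen_val, sgen_val]
  split_ifs <;> omega

theorem dD_sgen (n : ℕ) (i : Fin (n+1)) : dD n (sgen n i) = 4 := by
  have hi := i.isLt
  unfold dD
  by_cases h : (i : ℕ) < n
  · have hB : dB n (sgen n i) = 0 := by
      unfold dB
      simp only [Finset.card_eq_zero, Finset.filter_eq_empty_iff, Finset.mem_univ, true_implies]
      intro x
      have := x.isLt
      rw [sgen_val]
      split_ifs <;> omega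
    have hA : dA n (sgen n i) = 4 := by
      unfold dA
      let a : Fin (2*n+2) := ⟨i, by omega⟩
      let b : Fin (2*n+2) := ⟨i+1, by omega⟩
      let c : Fin (2*n+2) := ⟨2*n-i, by omega⟩
      let d : Fin (2*n+2) := ⟨2*n+1-i, by omega⟩
      have : (Finset.univ.filter (fun p : Fin (2*n+2) × Fin (2*n+2) =>
          ¬(p.1 < p.2 ↔ sgen n i p.1 < sgen n i p.2))) = {(a,b),(b,a),(c,d),(d,c)} := by
        ext ⟨x, y⟩
        have := x.isLt
        have := y.isLt
        simp only [Finset.mem_filter, Finset.mem_univ, true_and, Finset.mem_insert,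
          Finset.mem_singleton, Prod.mk.injEq, Fin.ext_iff, Fin.lt_def, a, b, c, d]
        rw [sgen_val, sgen_val, if_pos h, if_pos h]
        constructor
        · intro hh
          split_ifs at hh <;> omega
        · rintro (hh | hh | hh | hh) <;> split_ifs <;> omega
      rw [this]
      rw [Finset.card_insert_of_notMem, Finset.card_insert_of_notMem,
        Finset.card_insert_of_notMem, Finset.card_singleton] <;>
      · simp only [Finset.mem_insert,
          Finset.mem_singleton, Prod.mk.injEq, Fin.ext_iff, a, b, c, d]
        omega
    omega
  · let a : Fin (2*n+2) := ⟨n, by omega⟩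
    let b : Fin (2*n+2) := ⟨n+1, by omega⟩
    have hB : dB n (sgen n i) = 2 := by
      unfold dB
      have : (Finset.univ.filter (fun x : Fin (2*n+2) => ¬((x : ℕ) ≤ n ↔ (sgen n i x : ℕ) ≤ n)))
          = {a, b} := by
        ext x
        have := x.isLt
        simp only [Finset.mem_filter, Finset.mem_univ, true_and, Finset.mem_insert,
          Finset.mem_singleton, Fin.ext_iff, a, b]
        rw [sgen_val, if_neg h]
        split_ifs <;> omega
      rw [this, Finset.card_pair]
      simp [a, b]
    have hA : dA n (sgen n i) = 2 := by
      unfold dA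
      have : (Finset.univ.filter (fun p : Fin (2*n+2) × Fin (2*n+2) =>
          ¬(p.1 < p.2 ↔ sgen n i p.1 < sgen n i p.2))) = {(a,b),(b,a)} := by
        ext ⟨x, y⟩
        have := x.isLt
        have := y.isLt
        simp only [Finset.mem_filter, Finset.mem_univ, true_and, Finset.mem_insert,
          Finset.mem_singleton, Prod.mk.injEq, Fin.ext_iff, Fin.lt_def, a, b]
        rw [sgen_val, sgen_val, if_neg h, if_neg h]
        split_ifs <;> omega
      rw [this, Finset.card_pair]
      simp [a, b]
    omega

/-- a descent gives a shorter element -/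
theorem dD_descent {n : ℕ} {w : Equiv.Perm (Fin (2*n+2))} (hw : IsSigned n w) (i : Fin (n+1))
    (h : w ⟨(i : ℕ)+1, by omega⟩ < w ⟨i, by omega⟩) :
    dD n w = dD n (w * sgen n i) + 4 := by
  have hu : IsSigned n (w * sgen n i) := signed_mul hw (sgen_signed n i)
  have hr : Reduced n (w * sgen n i) (sgen n i) := by
    intro x y hxy hv
    have e : ∀ z, (w * sgen n i) (sgen n i z) = w z := by
      intro z
      have := congrArg (fun f : Equiv.Perm (Fin (2*n+2)) => w (f z)) (sgen_sq n i)
      simpa using this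
    rw [e, e]
    have hi := i.isLt
    have := x.isLt
    have := y.isLt
    have hc : ((x : ℕ) = i ∧ (y : ℕ) = i+1) ∨ ((x : ℕ) = 2*n-i ∧ (y : ℕ) = 2*n+1-i) := by
      rw [Fin.lt_def] at hxy hv
      rw [sgen_val, sgen_val] at hv
      split_ifs at hv <;> omega
    rcases hc with ⟨h1, h2⟩ | ⟨h1, h2⟩
    · have hx : x = ⟨i, by omega⟩ := Fin.ext h1
      have hy : y = ⟨(i : ℕ)+1, by omega⟩ := Fin.ext h2
      rw [congrArg w hx, congrArg w hy]; exact h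
    · have := signed_val hw x ⟨(i : ℕ)+1, by omega⟩ (by simp; omega)
      have := signed_val hw y ⟨i, by omega⟩ (by simp; omega)
      rw [Fin.lt_def] at h ⊢
      omega
  have := (dD_add_iff hu (sgen_signed n i)).2 hr
  rw [mul_assoc, sgen_sq, mul_one, dD_sgen] at this
  exact this

theorem signed_one (n : ℕ) : IsSigned n 1 := fun _ => rfl

theorem dD_one (n : ℕ) : dD n 1 = 0 := by
  simp [dD, dA, dB]

theorem dD_le_len (n : ℕ) (l : List (Fin (n+1))) :
    dD n (l.map (sgen n)).prod ≤ 4 * l.length := by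
  induction l with
  | nil => simp [dD_one]
  | cons i l ih =>
    simp only [List.map_cons, List.prod_cons, List.length_cons]
    have h1 := dA_mul n (sgen n i) (l.map (sgen n)).prod
    have h2 := dB_mul n (sgen n i) (l.map (sgen n)).prod
    have h3 := dD_sgen n i
    unfold dD at *
    omega

theorem eq_one_of_no_descent {n : ℕ} {w : Equiv.Perm (Fin (2*n+2))} (hw : IsSigned n w)
    (h : ∀ i : Fin (n+1), w ⟨i, by omega⟩ < w ⟨(i : ℕ)+1, by omega⟩) : w = 1 := by
  have hm : StrictMono w := by
    refine (Fin.strictMono_iff_lt_succ (n := 2*n+1) (f := w)).2 ?_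
    intro x
    by_cases hx : (x : ℕ) ≤ n
    · exact h ⟨x, by omega⟩
    · have h1 := h ⟨2*n - x, by omega⟩
      have := signed_val hw x.castSucc ⟨2*n-x+1, by omega⟩ (by simp; omega)
      have := signed_val hw x.succ ⟨2*n-x, by omega⟩ (by simp; omega)
      rw [Fin.lt_def] at h1 ⊢
      simp only at h1
      omega
  have hm2 : StrictMono w.symm := by
    intro a b hab
    rw [← hm.lt_iff_lt]; simpa using hab
  apply Equiv.ext
  intro x
  apply le_antisymm
  · have := hm2.le_apply (x := w x)
    simpa using this
  · exact hm.le_apply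

theorem exists_word (n : ℕ) : ∀ (N : ℕ) (w : Equiv.Perm (Fin (2*n+2))), IsSigned n w →
    dD n w ≤ N → ∃ l : List (Fin (n+1)), (l.map (sgen n)).prod = w ∧ 4 * l.length = dD n w := by
  intro N
  induction N with
  | zero =>
    intro w hw hN
    refine ⟨[], ?_, by simp; omega⟩
    simp only [List.map_nil, List.prod_nil]
    symm
    apply eq_one_of_no_descent hw
    intro i
    by_contra hc
    have hne : w ⟨i, by omega⟩ ≠ w ⟨(i : ℕ)+1, by omega⟩ := by
      intro he; have := w.injective he; simp at this
    have := dD_descent hw i (lt_of_le_of_ne (not_lt.1 hc) hne.symm)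
    omega
  | succ N ih =>
    intro w hw hN
    by_cases hd : ∀ i : Fin (n+1), w ⟨i, by omega⟩ < w ⟨(i : ℕ)+1, by omega⟩
    · have := eq_one_of_no_descent hw hd
      subst this
      exact ⟨[], by simp, by simp [dD_one]⟩
    · push Not at hd
      obtain ⟨i, hi⟩ := hd
      have hne : w ⟨i, by omega⟩ ≠ w ⟨(i : ℕ)+1, by omega⟩ := by
        intro he; have := w.injective he; simp at this
      have h4 := dD_descent hw i (lt_of_le_of_ne hi hne.symm)
      obtain ⟨l, hl, hlen⟩ := ih (w * sgen n i) (signed_mul hw (sgen_signed n i)) (by omega)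
      refine ⟨l ++ [i], ?_, ?_⟩
      · simp [hl, mul_assoc, sgen_sq]
      · simp; omega

theorem four_len {n : ℕ} {w : Equiv.Perm (Fin (2*n+2))} (hw : IsSigned n w) :
    4 * len n w = dD n w := by
  obtain ⟨l, hl, hlen⟩ := exists_word n _ w hw le_rfl
  have hmem : l.length ∈ {m | ∃ l : List (Fin (n+1)), l.length = m ∧
    (l.map (sgen n)).prod = w} := ⟨l, rfl, hl⟩
  have h1 : len n w ≤ l.length := Nat.sInf_le hmem
  obtain ⟨l', hl', hp⟩ := Nat.sInf_mem ⟨_, hmem⟩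
  have h2 := dD_le_len n l'
  rw [hp] at h2
  change l'.length = len n w at hl'
  omega

theorem len_add_iff {n : ℕ} {u v : Equiv.Perm (Fin (2*n+2))} (hu : IsSigned n u)
    (hv : IsSigned n v) : len n (u * v) = len n u + len n v ↔ Reduced n u v := by
  rw [← dD_add_iff hu hv]
  have := four_len hu
  have := four_len hv
  have := four_len (signed_mul hu hv)
  omega

/-- block of an index -/
def blk (n k x : ℕ) : ℕ := if x < k then 0 else if x ≤ 2*n+1-k then 1 else 2

theorem WP_prop {n k : ℕ} (hk : 1 ≤ k) (hkn : k ≤ n) {p : Equiv.Perm (Fin (2*n+2))}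
    (hp : p ∈ WP n k) : IsSigned n p ∧ ∀ x, blk n k (p x) = blk n k x := by
  induction hp using Subgroup.closure_induction with
  | mem x hx =>
    obtain ⟨i, hi, rfl⟩ := hx
    refine ⟨sgen_signed n i, ?_⟩
    intro x
    have := i.isLt
    have := x.isLt
    rw [sgen_val]
    unfold blk
    split_ifs <;> omega
  | one => exact ⟨signed_one n, fun _ => rfl⟩
  | mul u v _ _ hu hv =>
    refine ⟨signed_mul hu.1 hv.1, ?_⟩
    intro x
    rw [Equiv.Perm.mul_apply, hu.2, hv.2]
  | inv u _ hu =>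
    refine ⟨signed_inv hu.1, ?_⟩
    intro x
    rw [← hu.2]; simp

/-- increasing on each block -/
def Inc (n k : ℕ) (w : Equiv.Perm (Fin (2*n+2))) : Prop :=
  ∀ x y : Fin (2*n+2), x < y → blk n k x = blk n k y → w x < w y

theorem inc_of_step {n k : ℕ} (hk : 1 ≤ k) (hkn : k ≤ n) {w : Equiv.Perm (Fin (2*n+2))}
    (hw : IsSigned n w)
    (h : ∀ i : Fin (n+1), (i : ℕ) ≠ k-1 → w ⟨i, by omega⟩ < w ⟨(i : ℕ)+1, by omega⟩) :
    Inc n k w := by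
  have hstep : ∀ x : ℕ, ∀ hx : x + 1 < 2*n+2, x ≠ k-1 → x ≠ 2*n+1-k →
      w ⟨x, by omega⟩ < w ⟨x+1, hx⟩ := by
    intro x hx h1 h2
    by_cases hxn : x ≤ n
    · exact h ⟨x, by omega⟩ h1
    · have h1 := h ⟨2*n - x, by omega⟩ (by simp; omega)
      have := signed_val hw ⟨x, by omega⟩ ⟨2*n-x+1, by omega⟩ (by simp; omega)
      have := signed_val hw ⟨x+1, by omega⟩ ⟨2*n-x, by omega⟩ (by simp; omega)
      rw [Fin.lt_def] at h1 ⊢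
      simp only at h1
      omega
  have hgen : ∀ d x : ℕ, ∀ hx : x + d + 1 < 2*n+2, blk n k x = blk n k (x+d+1) →
      w ⟨x, by omega⟩ < w ⟨x+d+1, hx⟩ := by
    intro d
    induction d with
    | zero =>
      intro x hx hb
      apply hstep x hx <;> (unfold blk at hb; split_ifs at hb <;> omega)
    | succ d ih =>
      intro x hx hb
      refine lt_trans (ih x (by omega) ?_) (hstep (x+d+1) (by omega) ?_ ?_) <;>
      · unfold blk at *
        split_ifs at * <;> omega
  intro x y hxy hb
  have := hgen (y - x - 1) x (by have := y.isLt; omega) (by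
    rw [hb]; congr 1; rw [Fin.lt_def] at hxy; omega)
  have e : (⟨(x : ℕ) + (y - x - 1) + 1, by have := y.isLt; omega⟩ : Fin (2*n+2)) = y := by
    apply Fin.ext; simp only; rw [Fin.lt_def] at hxy; omega
  rw [e] at this
  exact this

theorem minRep_iff {n k : ℕ} (hk : 1 ≤ k) (hkn : k ≤ n) {w : Equiv.Perm (Fin (2*n+2))}
    (hw : IsSigned n w) : IsMinRep n k w ↔ Inc n k w := by
  constructor
  · intro hm
    apply inc_of_step hk hkn hw
    intro i hi
    by_contra hc
    have hne : w ⟨i, by omega⟩ ≠ w ⟨(i : ℕ)+1, by omega⟩ := by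
      intro he; have := w.injective he; simp at this
    have h4 := dD_descent hw i (lt_of_le_of_ne (not_lt.1 hc) hne.symm)
    have h5 := hm (sgen n i) (Subgroup.subset_closure ⟨i, hi, rfl⟩)
    have := four_len hw
    have := four_len (signed_mul hw (sgen_signed n i))
    omega
  · intro hinc p hp
    obtain ⟨hps, hpb⟩ := WP_prop hk hkn hp
    have : Reduced n w p := by
      intro i j hij hv
      apply hinc _ _ hv
      have h1 := hpb i
      have h2 := hpb j
      rw [Fin.lt_def] at hij hv
      unfold blk at *
      split_ifs at * <;> omega
    have := (len_add_iff hw hps).2 this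
    omega

/-- the explicit form of `O_2` -/
theorem O2_form (n k : ℕ) (hk : 1 < k) (hkn : k < n + 1)
    (O2 : Equiv.Perm (Fin (2*n+2)))
    (hO2s : IsSigned n O2) (hO2inc : Inc n k O2)
    (hO2a : (O2 ⟨0, Nat.succ_pos _⟩ : ℕ) = 0)
    (hO2b : ∀ j : ℕ, ∀ _h1 : 1 ≤ j, ∀ _hj : j + 1 < k, (O2 ⟨j, by omega⟩ : ℕ) = j + 1)
    (hO2c : (O2 ⟨k-1, by omega⟩ : ℕ) = 2*n) (x : Fin (2*n+2)) :
    (O2 x : ℕ) = if (x : ℕ) = 0 then 0 else if (x : ℕ) < k-1 then (x : ℕ) + 1 else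
      if (x : ℕ) = k-1 then 2*n else if (x : ℕ) ≤ 2*n+1-k then (x : ℕ) else
      if (x : ℕ) = 2*n+2-k then 1 else if (x : ℕ) ≤ 2*n then (x : ℕ) - 1 else 2*n+1 := by
  have low : ∀ x : Fin (2*n+2), (x : ℕ) < k → (O2 x : ℕ) = if (x : ℕ) = 0 then 0 else
      if (x : ℕ) < k-1 then (x : ℕ) + 1 else 2*n := by
    intro x hx
    split_ifs with h1 h2
    · have : x = ⟨0, Nat.succ_pos _⟩ := Fin.ext h1
      rw [congrArg O2 this]; exact hO2a
    · exact hO2b x (by omega) (by omega)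
    · have : x = ⟨k-1, by omega⟩ := Fin.ext (by simp only; omega)
      rw [congrArg O2 this]; exact hO2c
  have hinj : ∀ x y : Fin (2*n+2), (x : ℕ) ≠ y → (O2 x : ℕ) ≠ O2 y := by
    intro x y hxy he
    exact hxy (congrArg Fin.val (O2.injective (Fin.ext he)))
  have hmidk : k ≤ (O2 ⟨k, by omega⟩ : ℕ) := by
    by_contra hc
    set v := (O2 ⟨k, by omega⟩ : ℕ) with hv
    have hpos : ∃ y : Fin (2*n+2), (y : ℕ) ≠ k ∧ (O2 y : ℕ) = v := by
      by_cases h0 : v = 0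
      · exact ⟨⟨0, Nat.succ_pos _⟩, by simp only; omega, by rw [hO2a, h0]⟩
      by_cases h1 : v = 1
      · refine ⟨⟨2*n+2-k, by omega⟩, by simp only; omega, ?_⟩
        have := signed_val hO2s ⟨2*n+2-k, by omega⟩ ⟨k-1, by omega⟩ (by simp only; omega)
        omega
      · refine ⟨⟨v-1, by omega⟩, by simp only; omega, ?_⟩
        rw [hO2b (v-1) (by omega) (by omega)]; omega
    obtain ⟨y, hy, hy2⟩ := hpos
    exact hinj y ⟨k, by omega⟩ hy hy2
  have hmid1 : ∀ d : ℕ, ∀ h : k + d ≤ 2*n+1-k, k + d ≤ (O2 ⟨k+d, by omega⟩ : ℕ) := by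
    intro d
    induction d with
    | zero => intro h; exact hmidk
    | succ d ih =>
      intro h
      have h1 := ih (by omega)
      have h2 := hO2inc ⟨k+d, by omega⟩ ⟨k+(d+1), by omega⟩ (by rw [Fin.lt_def]; simp only; omega)
        (by unfold blk; simp only; split_ifs <;> omega)
      rw [Fin.lt_def] at h2
      omega
  have hmid2 : ∀ x : Fin (2*n+2), k ≤ (x : ℕ) → (x : ℕ) ≤ 2*n+1-k → (x : ℕ) ≤ O2 x := by
    intro x h1 h2
    have h3 := hmid1 (x - k) (by omega)
    have : x = ⟨k + (x - k), by omega⟩ := Fin.ext (by simp only; omega)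
    rw [← congrArg O2 this] at h3
    omega
  have hxlt := x.isLt
  have hb := signed_val hO2s x (bar n x) (by rw [bar_val]; omega)
  have hbv := bar_val n x
  by_cases c1 : (x : ℕ) < k
  · rw [low x c1]; split_ifs <;> omega
  by_cases c2 : (x : ℕ) ≤ 2*n+1-k
  · have := hmid2 x (by omega) c2
    have := hmid2 (bar n x) (by omega) (by omega)
    split_ifs <;> omega
  · have := low (bar n x) (by omega)
    split_ifs at * <;> omega

set_option maxHeartbeats 2000000 in
/-- Let `w ∈ W^{P_k} ∩ W^{odd}` with `w(1) = 1`, corresponding to `λ ∈ Λ` with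
`λ_1 = 2n+1-k`, and let `O_2 = (1 < 3 < 4 < ⋯ < k < \overline 2)`.  Then `λ**` exists
(i.e. `λ_2 = 2n-k`) iff `w O_2` is a minimal length representative in `W^{odd}` with
`ℓ(w O_2) = ℓ(w) + ℓ(O_2)`; in that case `w O_2` corresponds to `λ**`. -/
theorem stmt10 (n k : ℕ) (hk : 2 ≤ k) (hkn : k ≤ n)
    (w O2 : Equiv.Perm (Fin (2*n+2)))
    (hw : IsSigned n w) (hwmin : IsMinRep n k w) (hwodd : IsOddSymp n w)
    (hw1 : w ⟨0, by omega⟩ = ⟨0, by omega⟩)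
    (hO2s : IsSigned n O2) (hO2min : IsMinRep n k O2)
    (hO2a : (O2 ⟨0, by omega⟩ : ℕ) = 0)
    (hO2b : ∀ j : ℕ, ∀ _h1 : 1 ≤ j, ∀ _hj : j + 1 < k, (O2 ⟨j, by omega⟩ : ℕ) = j + 1)
    (hO2c : (O2 ⟨k-1, by omega⟩ : ℕ) = 2*n) :
    (partOf n k (by omega) w ⟨1, by omega⟩ = (2*n : ℤ) - k ↔
      IsMinRep n k (w * O2) ∧ IsOddSymp n (w * O2) ∧
        len n (w * O2) = len n w + len n O2) ∧
    (partOf n k (by omega) w ⟨1, by omega⟩ = (2*n : ℤ) - k →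
      ∀ j : Fin k, partOf n k (by omega) (w * O2) j =
        dstarP k (by omega) (partOf n k (by omega) w) j) := by
  have hwinc := (minRep_iff (by omega) hkn hw).1 hwmin
  have hO2inc := (minRep_iff (by omega) hkn hO2s).1 hO2min
  have hF := O2_form n k hk (by omega) O2 hO2s hO2inc hO2a hO2b hO2c
  have hws := signed_mul hw hO2s
  have hinj : ∀ x y : Fin (2*n+2), (x : ℕ) ≠ y → (w x : ℕ) ≠ w y := by
    intro x y hxy he
    exact hxy (congrArg Fin.val (w.injective (Fin.ext he)))
  have hcg : ∀ x y : Fin (2*n+2), (x : ℕ) = y → (w x : ℕ) = w y := by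
    intro x y hxy
    rw [Fin.ext hxy]
  have hw0 : (w ⟨0, by omega⟩ : ℕ) = 0 := by rw [hw1]
  have hwl : (w ⟨2*n+1, by omega⟩ : ℕ) = 2*n+1 := by
    have := signed_val hw ⟨0, by omega⟩ ⟨2*n+1, by omega⟩ (by simp)
    omega
  have hw12 := signed_val hw ⟨1, by omega⟩ ⟨2*n, by omega⟩ (by simp only; omega)
  have hlam : partOf n k (by omega) w ⟨1, by omega⟩ = (2*n : ℤ) - k ↔
      (w ⟨1, by omega⟩ : ℕ) = 1 := by
    unfold partOf
    rw [Finset.card_eq_zero.2]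
    · have : Fin.castLE (by omega) (⟨1, by omega⟩ : Fin k) = (⟨1, by omega⟩ : Fin (2*n+2)) := rfl
      rw [this]
      push_cast
      omega
    · rw [Finset.filter_eq_empty_iff]
      rintro i - ⟨h1, h2⟩
      rw [Fin.lt_def] at h1
      simp only at h1
      have := hcg (Fin.castLE (by omega) i) ⟨0, by omega⟩ (by simp only [Fin.val_castLE]; omega)
      have := (w (Fin.castLE (by omega) (⟨1, by omega⟩ : Fin k))).isLt
      omega
  rw [hlam]
  have hodd : IsOddSymp n (w * O2) := by
    intro j hj he
    rw [Equiv.Perm.mul_apply] at he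
    have h1 := hF j
    by_cases hc : (O2 j : ℕ) = 2*n+1
    · split_ifs at h1 <;> omega
    · exact hinj (O2 j) ⟨2*n+1, by omega⟩ hc (by rw [he, hwl])
  refine ⟨⟨?_, ?_⟩, ?_⟩
  · intro hone
    refine ⟨?_, hodd, ?_⟩
    · rw [minRep_iff (by omega) hkn hws]
      apply inc_of_step (by omega) hkn hws
      intro i hi
      have hilt := i.isLt
      rw [Fin.lt_def, Equiv.Perm.mul_apply, Equiv.Perm.mul_apply]
      have f1 := hF ⟨i, by omega⟩
      have f2 := hF ⟨(i : ℕ)+1, by omega⟩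
      simp only at f1 f2
      generalize O2 ⟨i, by omega⟩ = a at f1 ⊢
      generalize O2 ⟨(i : ℕ)+1, by omega⟩ = b at f2 ⊢
      have hb0 := hinj b ⟨0, by omega⟩
      have ha0 := hcg a ⟨0, by omega⟩
      have hbn := hcg b ⟨2*n, by omega⟩
      have han := hinj a ⟨2*n, by omega⟩
      have hal := hinj a ⟨2*n+1, by omega⟩
      have halt := (w a).isLt
      have hab := hwinc a b
      rw [Fin.lt_def, Fin.lt_def] at hab
      unfold blk at hab
      simp only at hb0 ha0 hbn han hal
      rw [if_neg (Nat.succ_ne_zero (i : ℕ))] at f2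
      by_cases c0 : (i : ℕ) = 0
      · rw [if_pos c0] at f1
        have : (b : ℕ) ≠ 0 := by split_ifs at f2 <;> omega
        omega
      by_cases c1 : (i : ℕ) + 1 < k - 1
      · have e1 : (a : ℕ) = i + 1 := by split_ifs at f1 <;> omega
        have e2 : (b : ℕ) = i + 2 := by split_ifs at f2 <;> omega
        apply hab (by omega)
        rw [if_pos (by omega), if_pos (by omega)]
      by_cases c2 : (i : ℕ) + 1 = k - 1
      · have e1 : (a : ℕ) = i + 1 := by split_ifs at f1 <;> omega
        have e2 : (b : ℕ) = 2*n := by split_ifs at f2 <;> omega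
        omega
      · have e1 : (a : ℕ) = i := by split_ifs at f1 <;> omega
        have e2 : (b : ℕ) = i + 1 := by split_ifs at f2 <;> omega
        apply hab (by omega)
        split_ifs <;> omega
    · rw [len_add_iff hw hO2s]
      intro i j hij hv
      have f1 := hF i
      have f2 := hF j
      have hilt := i.isLt
      have hjlt := j.isLt
      rw [Fin.lt_def] at hij hv ⊢
      generalize O2 i = a at *
      generalize O2 j = b at *
      have hc : (a : ℕ) = 2*n ∨ (b : ℕ) = 1 := by
        split_ifs at f1 <;> split_ifs at f2 <;> omega
      rcases hc with hc | hc
      · have := hcg a ⟨2*n, by omega⟩ hc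
        have := hinj b ⟨2*n, by omega⟩ (by simp only; omega)
        have := hinj b ⟨2*n+1, by omega⟩ (by simp only; omega)
        have := (w b).isLt
        omega
      · have := hcg b ⟨1, by omega⟩ hc
        have := hinj a ⟨1, by omega⟩ (by simp only; omega)
        have := hinj a ⟨0, by omega⟩ (by simp only; omega)
        omega
  · rintro ⟨hmin, -, hlen⟩
    rw [len_add_iff hw hO2s] at hlen
    rw [minRep_iff (by omega) hkn hws] at hmin
    have hk1 : O2 ⟨k-1, by omega⟩ = ⟨2*n, by omega⟩ := Fin.ext hO2c
    -- middle values are larger than `w(2)`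
    have hm : ∀ j : Fin (2*n+2), k ≤ (j : ℕ) → (j : ℕ) ≤ 2*n+1-k →
        (w j : ℕ) < w ⟨2*n, by omega⟩ := by
      intro j h1 h2
      have hj : O2 j = j := by
        apply Fin.ext
        rw [hF j]
        split_ifs <;> omega
      have := hlen ⟨k-1, by omega⟩ j (by rw [Fin.lt_def]; simp only; omega)
        (by rw [hj, hk1, Fin.lt_def]; simp only; omega)
      rw [hj, hk1, Fin.lt_def] at this
      exact this
    have hself : (w ⟨1, by omega⟩ : ℕ) < w ⟨2*n, by omega⟩ := by
      have hj : O2 ⟨2*n+2-k, by omega⟩ = ⟨1, by omega⟩ := by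
        apply Fin.ext
        rw [hF]
        simp only
        split_ifs <;> omega
      have := hlen ⟨k-1, by omega⟩ ⟨2*n+2-k, by omega⟩ (by rw [Fin.lt_def]; simp only; omega)
        (by rw [hj, hk1, Fin.lt_def]; simp only; omega)
      rw [hj, hk1, Fin.lt_def] at this
      exact this
    have hl : ∀ j : Fin (2*n+2), 2 ≤ (j : ℕ) → (j : ℕ) < k →
        (w j : ℕ) < w ⟨2*n, by omega⟩ := by
      intro j h1 h2
      have hj : O2 ⟨(j : ℕ)-1, by omega⟩ = j := by
        apply Fin.ext
        rw [hF]
        simp only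
        split_ifs <;> omega
      have := hmin ⟨(j : ℕ)-1, by omega⟩ ⟨k-1, by omega⟩ (by rw [Fin.lt_def]; simp only; omega)
        (by unfold blk; simp only; split_ifs <;> omega)
      rw [Equiv.Perm.mul_apply, Equiv.Perm.mul_apply, hj, hk1, Fin.lt_def] at this
      exact this
    have hl' : ∀ j : Fin (2*n+2), 2 ≤ (j : ℕ) → (j : ℕ) < k →
        (w ⟨1, by omega⟩ : ℕ) < w j := by
      intro j h1 h2
      have := hwinc ⟨1, by omega⟩ j (by rw [Fin.lt_def]; simp only; omega)
        (by unfold blk; simp only; split_ifs <;> omega)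
      rw [Fin.lt_def] at this
      exact this
    have hne := hinj ⟨1, by omega⟩ ⟨0, by omega⟩ (by simp)
    obtain ⟨x, hx⟩ := w.surjective ⟨1, by omega⟩
    have hx1 : (w x : ℕ) = 1 := by rw [hx]
    have hxlt := x.isLt
    have hbs := signed_val hw x (bar n x) (by rw [bar_val]; omega)
    have hbv := bar_val n x
    by_cases c0 : (x : ℕ) = 0
    · have := hcg x ⟨0, by omega⟩ c0
      omega
    by_cases c1 : (x : ℕ) = 1
    · have := hcg x ⟨1, by omega⟩ c1
      omega
    by_cases c2 : (x : ℕ) < k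
    · have := hl' x (by omega) c2
      omega
    by_cases c3 : (x : ℕ) ≤ 2*n+1-k
    · have := hm (bar n x) (by omega) (by omega)
      omega
    by_cases c4 : (x : ℕ) < 2*n
    · have := hl (bar n x) (by omega) (by omega)
      omega
    by_cases c5 : (x : ℕ) = 2*n
    · have := hcg x ⟨2*n, by omega⟩ c5
      omega
    · have := hcg x ⟨2*n+1, by omega⟩ (by simp only; omega)
      omega
  · intro hone j
    have hjlt := j.isLt
    have hsh : ∀ i : Fin k, ∀ _h0 : 0 < (i : ℕ), ∀ hi : (i : ℕ) + 1 < k,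
        ((w * O2) (Fin.castLE (by omega) i) : ℕ) =
          w (Fin.castLE (by omega) (⟨(i : ℕ)+1, hi⟩ : Fin k)) := by
      intro i h0 hi
      rw [Equiv.Perm.mul_apply]
      apply hcg
      rw [hF]
      simp only [Fin.val_castLE]
      split_ifs <;> omega
    have hz : ∀ i : Fin k, (i : ℕ) = 0 → ((w * O2) (Fin.castLE (by omega) i) : ℕ) = 0 := by
      intro i h0
      rw [Equiv.Perm.mul_apply, ← hw0]
      apply hcg
      rw [hF]
      simp [h0]
    unfold dstarP
    by_cases c0 : (j : ℕ) = 0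
    · rw [if_pos c0]
      unfold partOf
      rw [Finset.card_eq_zero.2, Finset.card_eq_zero.2, hz j c0]
      · have : (w (Fin.castLE (by omega) (⟨0, by omega⟩ : Fin k)) : ℕ) = 0 := hw0
        rw [this]
      · rw [Finset.filter_eq_empty_iff]
        rintro i - ⟨h1, -⟩
        rw [Fin.lt_def] at h1
        simp at h1
      · rw [Finset.filter_eq_empty_iff]
        rintro i - ⟨h1, -⟩
        rw [Fin.lt_def] at h1
        omega
    rw [if_neg c0]
    by_cases c1 : (j : ℕ) + 1 < k
    · rw [dif_pos c1]
      unfold partOf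
      rw [hsh j (by omega) c1]
      congr 2
      have hval : (w (Fin.castLE (by omega) (⟨(j : ℕ)+1, c1⟩ : Fin k)) : ℕ) ≠ 2*n+1 := by
        rw [← hwl]
        apply hinj
        simp only [Fin.val_castLE]
        omega
      have hval2 := (w (Fin.castLE (show k ≤ 2*n+2 by omega) (⟨(j : ℕ)+1, c1⟩ : Fin k))).isLt
      refine Finset.card_bij' (fun i _ => if h : (i : ℕ) + 1 < k then ⟨(i : ℕ)+1, h⟩ else i)
        (fun i _ => ⟨(i : ℕ) - 1, by omega⟩) ?_ ?_ ?_ ?_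
      · intro i hi
        simp only [Finset.mem_filter, Finset.mem_univ, true_and] at hi ⊢
        obtain ⟨h1, h2⟩ := hi
        rw [Fin.lt_def] at h1
        have hi0 : 0 < (i : ℕ) := by
          by_contra hc
          have := hz i (by omega)
          omega
        have hi1 : (i : ℕ) + 1 < k := by omega
        rw [hsh i hi0 hi1] at h2
        simp only [dif_pos hi1]
        refine ⟨?_, h2⟩
        rw [Fin.lt_def]
        simp only
        omega
      · intro i hi
        simp only [Finset.mem_filter, Finset.mem_univ, true_and] at hi ⊢
        obtain ⟨h1, h2⟩ := hi
        rw [Fin.lt_def] at h1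
        simp only at h1
        have hi0 : 1 < (i : ℕ) := by
          by_contra hc
          rcases (show (i : ℕ) = 0 ∨ (i : ℕ) = 1 by omega) with h | h
          · have := hcg (Fin.castLE (by omega) i) ⟨0, by omega⟩ h
            omega
          · have := hcg (Fin.castLE (by omega) i) ⟨1, by omega⟩ h
            omega
        have e : (⟨(i : ℕ) - 1 + 1, by omega⟩ : Fin k) = i := Fin.ext (by simp only; omega)
        rw [hsh ⟨(i : ℕ) - 1, by omega⟩ (by simp only; omega) (by simp only; omega)]
        simp only [e]
        refine ⟨?_, h2⟩
        rw [Fin.lt_def]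
        simp only
        omega
      · intro i hi
        simp only [Finset.mem_filter, Finset.mem_univ, true_and] at hi
        have h1 := hi.1
        rw [Fin.lt_def] at h1
        apply Fin.ext
        simp only [dif_pos (show (i : ℕ) + 1 < k by omega)]
        omega
      · intro i hi
        simp only [Finset.mem_filter, Finset.mem_univ, true_and] at hi
        obtain ⟨h1, h2⟩ := hi
        rw [Fin.lt_def] at h1
        have hi0 : 0 < (i : ℕ) := by
          by_contra hc
          have := hcg (Fin.castLE (by omega) i) ⟨0, by omega⟩ (by simp only [Fin.val_castLE]; omega)
          omega
        apply Fin.ext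
        rw [dif_pos (show (i : ℕ) - 1 + 1 < k by omega)]
        simp only
        omega
    · rw [dif_neg c1]
      unfold partOf
      have hlast : ((w * O2) (Fin.castLE (by omega) j) : ℕ) = 2*n := by
        rw [Equiv.Perm.mul_apply]
        have : (w (O2 (Fin.castLE (by omega) j)) : ℕ) = w ⟨2*n, by omega⟩ := by
          apply hcg
          rw [hF]
          simp only [Fin.val_castLE]
          split_ifs <;> omega
        omega
      rw [hlast]
      have hS : (Finset.univ.filter (fun i : Fin k => i < j ∧
          (((w * O2) (Fin.castLE (show k ≤ 2*n+2 by omega) i) : ℕ) + 1) + (2*n + 1) > 2*n+3))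
          = Finset.Ioo (⟨0, by omega⟩ : Fin k) j := by
        ext i
        simp only [Finset.mem_filter, Finset.mem_univ, true_and, Finset.mem_Ioo, Fin.lt_def]
        constructor
        · rintro ⟨h1, h2⟩
          refine ⟨?_, h1⟩
          by_contra hc
          have := hz i (by omega)
          omega
        · rintro ⟨h1, h2⟩
          refine ⟨h2, ?_⟩
          rw [hsh i h1 (by omega)]
          have h3 := hinj (Fin.castLE (show k ≤ 2*n+2 by omega) ⟨(i : ℕ)+1, by omega⟩)
            ⟨0, by omega⟩ (by simp)
          have h4 := hinj (Fin.castLE (show k ≤ 2*n+2 by omega) ⟨(i : ℕ)+1, by omega⟩)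
            ⟨1, by omega⟩ (by simp; omega)
          omega
      rw [hS, Fin.card_Ioo]
      simp only
      omega
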